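/- arXiv:2101.08125 — 4 statements merged into one kernel-verified Lean document; each statement's English description precedes it below -/
import Mathlib

section
/- Suppose the ESA hypothesis with tolerance ε ∈ (0,1) holds. Let 2 ≤ k ≤ n and let u : [0, t_k] → ℝ be continuously differentiable. Then |ᴸ¹D u(t_k) − ᶠD u(t_k)| ≤ (ε/Γ(2−α_k)) · t_k^{1−α_k} · max_{0 ≤ t ≤ t_{k−1}} |u′(t)|. -/
open Real MeasureTheory Finset

/-- Time step `Δt = T / n`. -/
noncomputable def dt (T : ℝ) (n : ℕ) : ℝ := T / n

/-- Time grid point `t_k = k Δt`. -/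
noncomputable def tk (T : ℝ) (n k : ℕ) : ℝ := k * dt T n

/-- Quadrature exponent `λ_i = e^{i h}`. -/
noncomputable def lamESA (h : ℝ) (i : ℤ) : ℝ := Real.exp ((i : ℝ) * h)

/-- Quadrature weight `θ_{a,i} = h e^{a i h} / Γ(a)`. -/
noncomputable def thESA (a h : ℝ) (i : ℤ) : ℝ := h * Real.exp (a * (i : ℝ) * h) / Real.Gamma a

/-- Piecewise-constant interpolation `Π₁u'` of the derivative:
`Π₁u'(τ) = (u(t_l) - u(t_{l-1}))/Δt` for `τ ∈ (t_{l-1}, t_l]`. -/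
noncomputable def Pi1 (T : ℝ) (n : ℕ) (u : ℝ → ℝ) (τ : ℝ) : ℝ :=
  (u (tk T n ⌈τ / dt T n⌉₊) - u (tk T n (⌈τ / dt T n⌉₊ - 1))) / dt T n

/-- The ESA hypothesis with tolerance `ε`:
`|s^{-a} - Σ_{i=Nlo+1}^{Nhi} θ_{a,i} e^{-λ_i s}| ≤ ε s^{-a}` for all `s ∈ [Dt/T, 1]`. -/
def ESAhyp (a Dt T ε h : ℝ) (Nlo Nhi : ℤ) : Prop :=
  ∀ s ∈ Set.Icc (Dt / T) 1,
    |s ^ (-a) - ∑ i ∈ Finset.Icc (Nlo + 1) Nhi, thESA a h i * Real.exp (-(lamESA h i) * s)|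
      ≤ ε * s ^ (-a)

/-- The L1 approximation formula
`ᴸ¹D u(t_k) = (1/Γ(1-a)) ∫_0^{t_k} Π₁u'(τ) (t_k - τ)^{-a} dτ` (with `a` the order at level `k`). -/
noncomputable def L1D (T : ℝ) (n : ℕ) (a : ℝ) (u : ℝ → ℝ) (k : ℕ) : ℝ :=
  (1 / Real.Gamma (1 - a)) * ∫ τ in (0:ℝ)..(tk T n k), Pi1 T n u τ * (tk T n k - τ) ^ (-a)

/-- History term `v_{k,i} = ∫_0^{t_{k-1}} Π₁u'(τ) e^{-λ_i (t_k - τ)/T} dτ`. -/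
noncomputable def vESA (T : ℝ) (n : ℕ) (u : ℝ → ℝ) (h : ℝ) (k : ℕ) (i : ℤ) : ℝ :=
  ∫ τ in (0:ℝ)..(tk T n (k-1)), Pi1 T n u τ * Real.exp (-(lamESA h i) * (tk T n k - τ) / T)

/-- The fast ESA approximation
`ᶠD u(t_k) = (T^{-a}/Γ(1-a)) Σ_i θ_{a,i} v_{k,i} + (u(t_k)-u(t_{k-1}))/(Δt^a Γ(2-a))`
(with `a` the order at level `k`; for `k = 1` the sum vanishes since `v_{1,i} = 0`). -/
noncomputable def FD (T : ℝ) (n : ℕ) (a : ℝ) (u : ℝ → ℝ) (h : ℝ) (Nlo Nhi : ℤ) (k : ℕ) : ℝ :=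
  (T ^ (-a) / Real.Gamma (1 - a)) *
      ∑ i ∈ Finset.Icc (Nlo + 1) Nhi, thESA a h i * vESA T n u h k i
    + (u (tk T n k) - u (tk T n (k-1))) / ((dt T n) ^ a * Real.Gamma (2 - a))

theorem tk_mono {T : ℝ} {n : ℕ} (hdt : 0 ≤ dt T n) : Monotone (tk T n) := fun i j hij => by
  unfold tk
  gcongr

theorem tk_nonneg {T : ℝ} {n : ℕ} (hdt : 0 ≤ dt T n) (j : ℕ) : 0 ≤ tk T n j :=
  mul_nonneg (Nat.cast_nonneg j) hdt

theorem tk_succ (T : ℝ) (n j : ℕ) : tk T n (j + 1) = tk T n j + dt T n := by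
  simp only [tk]
  push_cast
  ring

theorem Pi1_eq_of_mem_Ioc {T : ℝ} {n : ℕ} (hdt : 0 < dt T n) (u : ℝ → ℝ) {l : ℕ} {τ : ℝ}
    (hτ : τ ∈ Set.Ioc (tk T n l) (tk T n (l + 1))) :
    Pi1 T n u τ = (u (tk T n (l + 1)) - u (tk T n l)) / dt T n := by
  have hceil : ⌈τ / dt T n⌉₊ = l + 1 := by
    rw [Nat.ceil_eq_iff l.succ_ne_zero]
    exact ⟨(lt_div_iff₀ hdt).2 hτ.1, (div_le_iff₀ hdt).2 hτ.2⟩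
  simp [Pi1, hceil]

theorem measurable_Pi1 (T : ℝ) (n : ℕ) (u : ℝ → ℝ) : Measurable (Pi1 T n u) := by
  have hf : Measurable fun j : ℕ => (u (tk T n j) - u (tk T n (j - 1))) / dt T n :=
    measurable_of_countable _
  exact hf.comp (Nat.measurable_ceil.comp (measurable_id.div_const _))

theorem abs_Pi1_le {T : ℝ} {n : ℕ} (hdt : 0 < dt T n) {u : ℝ → ℝ} (hu : Differentiable ℝ u)
    {m : ℕ} {C : ℝ} (hC : ∀ s ∈ Set.Icc 0 (tk T n m), |deriv u s| ≤ C) {τ : ℝ}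
    (hτ : τ ∈ Set.Ioc 0 (tk T n m)) : |Pi1 T n u τ| ≤ C := by
  obtain ⟨l, hl⟩ : ∃ l, ⌈τ / dt T n⌉₊ = l + 1 :=
    Nat.exists_eq_succ_of_ne_zero (Nat.ceil_pos.2 (div_pos hτ.1 hdt)).ne'
  have hlm : l + 1 ≤ m := hl ▸ Nat.ceil_le.2 ((div_le_iff₀ hdt).2 hτ.2)
  obtain ⟨hl1, hl2⟩ := (Nat.ceil_eq_iff l.succ_ne_zero).1 hl
  rw [Pi1_eq_of_mem_Ioc hdt u ⟨(lt_div_iff₀ hdt).1 hl1, (div_le_iff₀ hdt).1 hl2⟩, abs_div,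
    abs_of_pos hdt, div_le_iff₀ hdt]
  have hmvt := (convex_Icc 0 (tk T n m)).norm_image_sub_le_of_norm_deriv_le
    (fun s _ => hu s) hC
    ⟨tk_nonneg hdt.le l, tk_mono hdt.le (l.le_succ.trans hlm)⟩
    ⟨tk_nonneg hdt.le (l + 1), tk_mono hdt.le hlm⟩
  simpa [tk_succ, abs_of_pos hdt] using hmvt

theorem intervalIntegrable_const_sub_rpow {a : ℝ} (ha : a < 1) (X c d : ℝ) :
    IntervalIntegrable (fun τ => (X - τ) ^ (-a)) volume c d := by
  simpa using (intervalIntegral.intervalIntegrable_rpow' (r := -a) (a := X - c) (b := X - d)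
    (by linarith)).comp_sub_left X

theorem integral_const_sub_rpow {a : ℝ} (ha : a < 1) (X c d : ℝ) :
    ∫ τ in c..d, (X - τ) ^ (-a) = ((X - c) ^ (1 - a) - (X - d) ^ (1 - a)) / (1 - a) := by
  rw [intervalIntegral.integral_comp_sub_left (fun x => x ^ (-a)),
    integral_rpow (Or.inl (by linarith)), neg_add_eq_sub]

theorem intervalIntegrable_Pi1_mul {T : ℝ} {n : ℕ} (hdt : 0 < dt T n) {u : ℝ → ℝ}
    (hu : ContDiff ℝ 1 u) (m : ℕ) {f : ℝ → ℝ}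
    (hf : IntervalIntegrable f volume 0 (tk T n m)) :
    IntervalIntegrable (fun τ => Pi1 T n u τ * f τ) volume 0 (tk T n m) := by
  obtain ⟨C, hC⟩ := isCompact_Icc.exists_bound_of_continuousOn (s := Set.Icc 0 (tk T n m))
    (hu.continuous_deriv le_rfl).continuousOn
  rw [intervalIntegrable_iff_integrableOn_Ioc_of_le (tk_nonneg hdt.le m)] at hf ⊢
  refine Integrable.bdd_mul (c := C) hf (measurable_Pi1 T n u).aestronglyMeasurable ?_
  filter_upwards [ae_restrict_mem measurableSet_Ioc] with τ hτ
  exact abs_Pi1_le hdt (hu.differentiable one_ne_zero) hC hτ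

theorem integral_Pi1_last_cell {T : ℝ} {n : ℕ} (hdt : 0 < dt T n) (u : ℝ → ℝ) {a : ℝ}
    (ha : a < 1) (m : ℕ) :
    ∫ τ in (tk T n m)..(tk T n (m + 1)), Pi1 T n u τ * (tk T n (m + 1) - τ) ^ (-a) =
      (u (tk T n (m + 1)) - u (tk T n m)) / (dt T n ^ a * (1 - a)) := by
  have hcongr : ∀ᵐ τ, τ ∈ Set.uIoc (tk T n m) (tk T n (m + 1)) →
      Pi1 T n u τ * (tk T n (m + 1) - τ) ^ (-a) =
        (u (tk T n (m + 1)) - u (tk T n m)) / dt T n * (tk T n (m + 1) - τ) ^ (-a) := by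
    refine Filter.Eventually.of_forall fun τ hτ => ?_
    rw [Set.uIoc_of_le (tk_mono hdt.le m.le_succ)] at hτ
    rw [Pi1_eq_of_mem_Ioc hdt u hτ]
  have ha' : 1 - a ≠ 0 := by linarith
  rw [intervalIntegral.integral_congr_ae hcongr, intervalIntegral.integral_const_mul,
    integral_const_sub_rpow ha, sub_self, Real.zero_rpow ha', sub_zero, tk_succ,
    add_sub_cancel_left, Real.rpow_sub hdt, Real.rpow_one]
  have := (Real.rpow_pos_of_pos hdt a).ne'
  field_simp

theorem ESAhyp.abs_kernel_sub_le {a Dt T ε h : ℝ} {Nlo Nhi : ℤ} (hT : 0 < T) (hDt : 0 ≤ Dt)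
    (H : ESAhyp a Dt T ε h Nlo Nhi) {r : ℝ} (hr : r ∈ Set.Icc Dt T) :
    |r ^ (-a) - T ^ (-a) * ∑ i ∈ Finset.Icc (Nlo + 1) Nhi,
      thESA a h i * Real.exp (-(lamESA h i) * r / T)| ≤ ε * r ^ (-a) := by
  have hs := H (r / T) ⟨by gcongr; exact hr.1, (div_le_one hT).2 hr.2⟩
  have hr0 : 0 ≤ r := hDt.trans hr.1
  have hTa : 0 < T ^ (-a) := Real.rpow_pos_of_pos hT _
  have hscale : r ^ (-a) = T ^ (-a) * (r / T) ^ (-a) := by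
    rw [← Real.mul_rpow hT.le (by positivity), mul_div_cancel₀ _ hT.ne']
  simp only [mul_div_assoc]
  rw [hscale, ← mul_sub, abs_mul, abs_of_pos hTa]
  calc _ ≤ T ^ (-a) * (ε * (r / T) ^ (-a)) := by gcongr
    _ = _ := by ring

theorem sum_thESA_mul_vESA {T : ℝ} {n : ℕ} (hdt : 0 < dt T n) {u : ℝ → ℝ}
    (hu : ContDiff ℝ 1 u) (a h : ℝ) (Nlo Nhi : ℤ) (k : ℕ) :
    ∑ i ∈ Finset.Icc (Nlo + 1) Nhi, thESA a h i * vESA T n u h k i =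
      ∫ τ in (0:ℝ)..(tk T n (k - 1)), Pi1 T n u τ * ∑ i ∈ Finset.Icc (Nlo + 1) Nhi,
        thESA a h i * Real.exp (-(lamESA h i) * (tk T n k - τ) / T) := by
  simp only [vESA, ← intervalIntegral.integral_const_mul, Finset.mul_sum]
  rw [← intervalIntegral.integral_finsetSum]
  · simp only [mul_left_comm]
  · intro i _
    refine (intervalIntegrable_Pi1_mul hdt hu (k - 1) ?_).const_mul _
    exact Continuous.intervalIntegrable (by fun_prop) _ _

theorem L1D_sub_FD_succ {T : ℝ} {n : ℕ} (hdt : 0 < dt T n) {u : ℝ → ℝ} (hu : ContDiff ℝ 1 u)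
    {a : ℝ} (ha : a < 1) (h : ℝ) (Nlo Nhi : ℤ) (m : ℕ) :
    L1D T n a u (m + 1) - FD T n a u h Nlo Nhi (m + 1) =
      (1 / Real.Gamma (1 - a)) * ∫ τ in (0:ℝ)..(tk T n m), Pi1 T n u τ *
        ((tk T n (m + 1) - τ) ^ (-a) - T ^ (-a) * ∑ i ∈ Finset.Icc (Nlo + 1) Nhi,
          thESA a h i * Real.exp (-(lamESA h i) * (tk T n (m + 1) - τ) / T)) := by
  have hK := intervalIntegrable_const_sub_rpow ha (tk T n (m + 1))
  have hall := intervalIntegrable_Pi1_mul hdt hu (m + 1) (hK 0 (tk T n (m + 1)))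
  have hfst := intervalIntegrable_Pi1_mul hdt hu m (hK 0 (tk T n m))
  have hE : IntervalIntegrable (fun τ => ∑ i ∈ Finset.Icc (Nlo + 1) Nhi,
      thESA a h i * Real.exp (-(lamESA h i) * (tk T n (m + 1) - τ) / T)) volume 0 (tk T n m) :=
    Continuous.intervalIntegrable (by fun_prop) _ _
  have hsnd := (intervalIntegrable_Pi1_mul hdt hu m hE).const_mul (T ^ (-a))
  have hGamma : Real.Gamma (2 - a) = (1 - a) * Real.Gamma (1 - a) := by
    rw [← Real.Gamma_add_one (by linarith)]
    ring_nf
  simp only [mul_sub (Pi1 T n u _), mul_left_comm (Pi1 T n u _) (T ^ (-a))]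
  rw [intervalIntegral.integral_sub hfst hsnd, intervalIntegral.integral_const_mul, L1D, FD,
    sum_thESA_mul_vESA hdt hu, Nat.add_sub_cancel,
    ← intervalIntegral.integral_add_adjacent_intervals hfst (hfst.symm.trans hall),
    integral_Pi1_last_cell hdt u ha, hGamma]
  have hG : Real.Gamma (1 - a) ≠ 0 := (Real.Gamma_pos_of_pos (by linarith)).ne'
  have ha' : 1 - a ≠ 0 := by linarith
  have := (Real.rpow_pos_of_pos hdt a).ne'
  field_simp
  ring

/-- Lemma 4: under the ESA hypothesis with tolerance ε, for 2 ≤ k ≤ n and u ∈ C¹,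
|ᴸ¹D u(t_k) − ᶠD u(t_k)| ≤ (ε/Γ(2−α_k)) t_k^{1−α_k} max_{0≤t≤t_{k−1}} |u′(t)|. -/
theorem l1_sub_fast_bound
    (T : ℝ) (hT : 1 ≤ T) (n : ℕ) (hn : 0 < n)
    (alo ahi : ℝ) (halo : 0 < alo) (hlh : alo ≤ ahi) (hahi : ahi < 1)
    (αf : ℝ → ℝ) (hα : ∀ s ∈ Set.Icc (0:ℝ) T, αf s ∈ Set.Icc alo ahi)
    (h : ℝ) (hh : 0 < h) (Nlo Nhi : ℤ) (hN : Nlo < Nhi)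
    (ε : ℝ) (hε : ε ∈ Set.Ioo (0:ℝ) 1)
    (k : ℕ) (hk2 : 2 ≤ k) (hkn : k ≤ n)
    (u : ℝ → ℝ) (hu : ContDiff ℝ 1 u)
    (hesa : ESAhyp (αf (tk T n k)) (dt T n) T ε h Nlo Nhi) :
    |L1D T n (αf (tk T n k)) u k - FD T n (αf (tk T n k)) u h Nlo Nhi k| ≤
      (ε / Real.Gamma (2 - αf (tk T n k))) * (tk T n k) ^ (1 - αf (tk T n k)) *
        sSup ((fun s => |deriv u s|) '' Set.Icc (0:ℝ) (tk T n (k-1))) := by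
  have hT0 : 0 < T := by linarith
  have hdt : 0 < dt T n := div_pos hT0 (Nat.cast_pos.2 hn)
  have htn : tk T n n = T := mul_div_cancel₀ T (Nat.cast_pos.2 hn).ne'
  have hkT : tk T n k ≤ T := (tk_mono hdt.le hkn).trans_eq htn
  have ha : αf (tk T n k) < 1 := (hα _ ⟨tk_nonneg hdt.le k, hkT⟩).2.trans_lt hahi
  generalize αf (tk T n k) = a at *
  obtain ⟨m, rfl⟩ : ∃ m, k = m + 1 := ⟨k - 1, by omega⟩
  have hm0 := tk_nonneg hdt.le m
  rw [L1D_sub_FD_succ hdt hu ha, Nat.add_sub_cancel]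
  set M := sSup ((fun s => |deriv u s|) '' Set.Icc (0:ℝ) (tk T n m))
  have hM : ∀ s ∈ Set.Icc 0 (tk T n m), |deriv u s| ≤ M := fun s hs =>
    le_csSup (isCompact_Icc.bddAbove_image (hu.continuous_deriv le_rfl).abs.continuousOn)
      (Set.mem_image_of_mem _ hs)
  have hM0 : 0 ≤ M := (abs_nonneg _).trans (hM 0 ⟨le_rfl, hm0⟩)
  have hG : 0 < Real.Gamma (1 - a) := Real.Gamma_pos_of_pos (by linarith)
  have ha' : 0 < 1 - a := by linarith
  have hint : |∫ τ in (0:ℝ)..(tk T n m), Pi1 T n u τ *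
      ((tk T n (m + 1) - τ) ^ (-a) - T ^ (-a) * ∑ i ∈ Finset.Icc (Nlo + 1) Nhi,
        thESA a h i * Real.exp (-(lamESA h i) * (tk T n (m + 1) - τ) / T))| ≤
      M * ε * (tk T n (m + 1) ^ (1 - a) / (1 - a)) := by
    calc _ ≤ ∫ τ in (0:ℝ)..(tk T n m), M * ε * (tk T n (m + 1) - τ) ^ (-a) := by
          rw [← Real.norm_eq_abs]
          refine intervalIntegral.norm_integral_le_of_norm_le hm0
            (Filter.Eventually.of_forall fun τ hτ => ?_)
            ((intervalIntegrable_const_sub_rpow ha _ _ _).const_mul _)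
          rw [norm_mul, Real.norm_eq_abs, Real.norm_eq_abs, mul_assoc]
          refine mul_le_mul (abs_Pi1_le hdt (hu.differentiable one_ne_zero) hM hτ)
            (hesa.abs_kernel_sub_le hT0 hdt.le ⟨?_, ?_⟩) (abs_nonneg _) hM0
          · linarith [hτ.2, tk_succ T n m]
          · linarith [hτ.1]
      _ = M * ε * ((tk T n (m + 1) ^ (1 - a) - dt T n ^ (1 - a)) / (1 - a)) := by
          rw [intervalIntegral.integral_const_mul, integral_const_sub_rpow ha, sub_zero]
          congr 4
          rw [tk_succ, add_sub_cancel_left]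
      _ ≤ _ := by
          have hε0 := hε.1.le
          gcongr
          exact sub_le_self _ (Real.rpow_nonneg hdt.le _)
  have hGamma : Real.Gamma (2 - a) = (1 - a) * Real.Gamma (1 - a) := by
    rw [← Real.Gamma_add_one ha'.ne']
    ring_nf
  rw [abs_mul, abs_of_pos (one_div_pos.2 hG)]
  calc _ ≤ 1 / Real.Gamma (1 - a) * (M * ε * (tk T n (m + 1) ^ (1 - a) / (1 - a))) := by gcongr
    _ = _ := by
      rw [hGamma]
      field_simp
end

section
/- Suppose the ESA hypothesis with tolerance ε ∈ (0,1) holds. Then for every 2 ≤ k ≤ n, b_{k−1}^k + ε_k ≥ 2 − 2^{1−α_k} > 0. -/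
open Real MeasureTheory Finset

/-- `Ib k j = Σ_i θ_{a,i} ∫_{t_{j-1}}^{t_j} e^{-λ_i (t_k - τ)/T} dτ`. -/
noncomputable def Ib (T : ℝ) (n : ℕ) (a h : ℝ) (Nlo Nhi : ℤ) (k j : ℕ) : ℝ :=
  ∑ i ∈ Finset.Icc (Nlo + 1) Nhi,
    thESA a h i * ∫ τ in (tk T n (j-1))..(tk T n j), Real.exp (-(lamESA h i) * (tk T n k - τ) / T)

/-- The coefficients `b_l^k` of the fast ESA scheme (with `a` the order at level `k`):
`b_0^1 = 1`; for `k ≥ 2`, `b_0^k = T^{-a} Δt^{a-1}(1-a) Ib k 1`,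
`b_{k-1}^k = 1 - T^{-a} Δt^{a-1}(1-a) Ib k (k-1)`, and
`b_l^k = T^{-a} Δt^{a-1}(1-a) (Ib k (l+1) - Ib k l)` for `1 ≤ l ≤ k-2`. -/
noncomputable def bcoef (T : ℝ) (n : ℕ) (a h : ℝ) (Nlo Nhi : ℤ) (k l : ℕ) : ℝ :=
  if k = 1 then 1
  else if l = 0 then T ^ (-a) * (dt T n) ^ (a - 1) * (1 - a) * Ib T n a h Nlo Nhi k 1
  else if l = k - 1 then
    1 - T ^ (-a) * (dt T n) ^ (a - 1) * (1 - a) * Ib T n a h Nlo Nhi k (k-1)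
  else T ^ (-a) * (dt T n) ^ (a - 1) * (1 - a) *
    (Ib T n a h Nlo Nhi k (l+1) - Ib T n a h Nlo Nhi k l)

/-- `ε_k = (ε/(1+ε)) T^{-a} Δt^{a-1} (1-a) Σ_i θ_{a,i} ∫_{t_{k-2}}^{t_{k-1}} e^{-λ_i(t_k-τ)/T} dτ`. -/
noncomputable def epsk (T : ℝ) (n : ℕ) (a h ε : ℝ) (Nlo Nhi : ℤ) (k : ℕ) : ℝ :=
  (ε / (1 + ε)) * T ^ (-a) * (dt T n) ^ (a - 1) * (1 - a) * Ib T n a h Nlo Nhi k (k-1)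

theorem Ib_pred_eq_integral (T : ℝ) (n : ℕ) (a h : ℝ) (Nlo Nhi : ℤ) {k : ℕ} (hk : 2 ≤ k) :
    Ib T n a h Nlo Nhi k (k - 1) = ∫ s in (dt T n)..(2 * dt T n),
      ∑ i ∈ Finset.Icc (Nlo + 1) Nhi, thESA a h i * Real.exp (-(lamESA h i) * (s / T)) := by
  obtain ⟨m, rfl⟩ := Nat.exists_eq_add_of_le' hk
  rw [intervalIntegral.integral_finsetSum
    (fun i _ => (by fun_prop : Continuous fun s : ℝ =>
      thESA a h i * Real.exp (-(lamESA h i) * (s / T))).intervalIntegrable _ _)]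
  unfold Ib
  refine Finset.sum_congr rfl fun i _ => ?_
  rw [intervalIntegral.integral_const_mul]
  have key := intervalIntegral.integral_comp_sub_left
    (fun s : ℝ => Real.exp (-(lamESA h i) * (s / T))) (tk T n (m + 2))
    (a := tk T n (m + 2 - 1 - 1)) (b := tk T n (m + 2 - 1))
  have h1 : tk T n (m + 2) - tk T n (m + 2 - 1) = dt T n := by
    simp only [tk, show m + 2 - 1 = m + 1 by omega]
    push_cast
    ring
  have h2 : tk T n (m + 2) - tk T n (m + 2 - 1 - 1) = 2 * dt T n := by
    simp only [tk, show m + 2 - 1 - 1 = m by omega]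
    push_cast
    ring
  rw [h1, h2] at key
  rw [← key]
  simp only [mul_div_assoc]

theorem integral_div_rpow_neg {T d a : ℝ} (hT : 0 < T) (hd : 0 < d) (ha : a < 1) :
    ∫ s in d..(2 * d), (s / T) ^ (-a) =
      T ^ a * (d ^ (1 - a) * ((2 : ℝ) ^ (1 - a) - 1) / (1 - a)) := by
  have hcongr : Set.EqOn (fun s : ℝ => (s / T) ^ (-a)) (fun s => T ^ a * s ^ (-a))
      (Set.uIcc d (2 * d)) := by
    intro s hs
    rw [Set.uIcc_of_le (by linarith)] at hs
    have hs0 : 0 ≤ s := hd.le.trans hs.1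
    simp only [Real.div_rpow hs0 hT.le, Real.rpow_neg hT.le, div_inv_eq_mul, mul_comm]
  rw [intervalIntegral.integral_congr hcongr, intervalIntegral.integral_const_mul,
    integral_rpow (Or.inl (by linarith)), Real.mul_rpow zero_le_two hd.le]
  rw [show -a + 1 = 1 - a by ring,
    show (2 : ℝ) ^ (1 - a) * d ^ (1 - a) - d ^ (1 - a)
      = d ^ (1 - a) * ((2 : ℝ) ^ (1 - a) - 1) by ring]

theorem ESAhyp.sum_le {a D T ε h : ℝ} {Nlo Nhi : ℤ} (H : ESAhyp a D T ε h Nlo Nhi) {s : ℝ}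
    (hs : s ∈ Set.Icc (D / T) 1) :
    ∑ i ∈ Finset.Icc (Nlo + 1) Nhi, thESA a h i * Real.exp (-(lamESA h i) * s)
      ≤ (1 + ε) * s ^ (-a) := by
  linarith [(abs_le.mp (H s hs)).1]

theorem Ib_pred_le {T : ℝ} (hT : 0 < T) {n : ℕ} {a h ε : ℝ} (ha : a < 1) {Nlo Nhi : ℤ}
    {k : ℕ} (hk : 2 ≤ k) (hkn : k ≤ n) (H : ESAhyp a (dt T n) T ε h Nlo Nhi) :
    Ib T n a h Nlo Nhi k (k - 1) ≤
      (1 + ε) * (T ^ a * (dt T n ^ (1 - a) * ((2 : ℝ) ^ (1 - a) - 1) / (1 - a))) := by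
  have hn : (2 : ℝ) ≤ n := by exact_mod_cast hk.trans hkn
  have hd : 0 < dt T n := div_pos hT (by linarith)
  have hdT : 2 * dt T n ≤ T := by
    rw [dt, ← mul_div_assoc, div_le_iff₀ (by linarith)]
    nlinarith
  rw [Ib_pred_eq_integral T n a h Nlo Nhi hk, ← integral_div_rpow_neg hT hd ha,
    ← intervalIntegral.integral_const_mul]
  refine intervalIntegral.integral_mono_on (by linarith)
    (Continuous.intervalIntegrable (by fun_prop) _ _)
    (ContinuousOn.intervalIntegrable fun s hs => ?_) fun s hs => H.sum_le ⟨?_, ?_⟩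
  · rw [Set.uIcc_of_le (by linarith)] at hs
    have hs0 : s / T ≠ 0 := (div_pos (hd.trans_le hs.1) hT).ne'
    exact (continuousAt_const.mul ((continuousAt_id.div_const T).rpow_const
      (Or.inl hs0))).continuousWithinAt
  · exact div_le_div_of_nonneg_right hs.1 hT.le
  · exact (div_le_one hT).2 (hs.2.trans hdT)

/-- Lemma 5 ii): under the ESA hypothesis, b_{k−1}^k + ε_k ≥ 2 − 2^{1−α_k} > 0. -/
theorem bcoef_last_plus_epsk_pos
    (T : ℝ) (hT : 1 ≤ T) (n : ℕ) (hn : 0 < n)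
    (alo ahi : ℝ) (halo : 0 < alo) (hlh : alo ≤ ahi) (hahi : ahi < 1)
    (αf : ℝ → ℝ) (hα : ∀ s ∈ Set.Icc (0:ℝ) T, αf s ∈ Set.Icc alo ahi)
    (h : ℝ) (hh : 0 < h) (Nlo Nhi : ℤ) (hN : Nlo < Nhi)
    (ε : ℝ) (hε : ε ∈ Set.Ioo (0:ℝ) 1)
    (k : ℕ) (hk2 : 2 ≤ k) (hkn : k ≤ n)
    (hesa : ESAhyp (αf (tk T n k)) (dt T n) T ε h Nlo Nhi) :
    2 - (2:ℝ) ^ (1 - αf (tk T n k))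
        ≤ bcoef T n (αf (tk T n k)) h Nlo Nhi k (k-1)
            + epsk T n (αf (tk T n k)) h ε Nlo Nhi k
      ∧ 0 < 2 - (2:ℝ) ^ (1 - αf (tk T n k)) := by
  have hn0 : (0 : ℝ) < n := by exact_mod_cast hn
  have hT0 : 0 < T := by linarith
  have hd : 0 < dt T n := div_pos hT0 hn0
  have hmem : tk T n k ∈ Set.Icc (0 : ℝ) T := by
    have hkn' : (k : ℝ) ≤ n := by exact_mod_cast hkn
    refine ⟨mul_nonneg k.cast_nonneg hd.le, ?_⟩
    calc tk T n k ≤ n * dt T n := mul_le_mul_of_nonneg_right hkn' hd.le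
      _ = T := mul_div_cancel₀ T hn0.ne'
  obtain ⟨ha_lo, ha_hi⟩ := hα _ hmem
  set a := αf (tk T n k)
  have ha0 : 0 < a := halo.trans_le ha_lo
  have ha1 : a < 1 := ha_hi.trans_lt hahi
  have hε1 : 0 < 1 + ε := by linarith [hε.1]
  refine ⟨?_, ?_⟩
  · set C := T ^ (-a) * dt T n ^ (a - 1) * (1 - a) with hC
    have hC0 : 0 < C := by
      have : 0 < 1 - a := by linarith
      positivity
    have hbound : C / (1 + ε) * Ib T n a h Nlo Nhi k (k - 1) ≤ (2 : ℝ) ^ (1 - a) - 1 := by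
      refine (mul_le_mul_of_nonneg_left (Ib_pred_le hT0 ha1 hk2 hkn hesa)
        (by positivity)).trans_eq ?_
      have h1a : 1 - a ≠ 0 := by linarith
      have hTa : T ^ (-a) * T ^ a = 1 := by rw [← Real.rpow_add hT0]; simp
      have hda : dt T n ^ (a - 1) * dt T n ^ (1 - a) = 1 := by rw [← Real.rpow_add hd]; simp
      calc _ = (T ^ (-a) * T ^ a) * (dt T n ^ (a - 1) * dt T n ^ (1 - a))
            * ((2 : ℝ) ^ (1 - a) - 1) := by rw [hC]; field_simp
        _ = _ := by rw [hTa, hda]; ring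
    have hsum : bcoef T n a h Nlo Nhi k (k - 1) + epsk T n a h ε Nlo Nhi k
        = 1 - C / (1 + ε) * Ib T n a h Nlo Nhi k (k - 1) := by
      rw [bcoef, if_neg (by omega), if_neg (by omega), if_pos rfl, epsk, hC]
      field_simp
      ring
    linarith
  · have : (2 : ℝ) ^ (1 - a) < 2 ^ (1 : ℝ) :=
      Real.rpow_lt_rpow_of_exponent_lt one_lt_two (by linarith)
    rw [Real.rpow_one] at this
    linarith
end

section
/- Suppose the ESA hypothesis with tolerance ε ∈ (0,1) holds. Then for every 2 ≤ k ≤ n, ε_k ≤ ε·(2^{1−α_k} − 1), and consequently Σ_{l=0}^{k−1} b_l^k + 2·ε_k ≤ 1 + 2·ε·(2^{1−α_k} − 1) ≤ 1 + 2ε. -/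
open Real MeasureTheory Finset

/-- The sum of exponentials integrated over the grid cell `[t_m, t_{m+1}]`, seen from the time
`t_{m+2}`, is at most `1 + ε` times the integral of `(x / T) ^ (-a)` over `[Δt, 2 Δt]`. -/
theorem Ib_penultimate_le {T : ℝ} (hT : 0 < T) {n : ℕ} {a : ℝ} (ha1 : a < 1)
    {h : ℝ} {Nlo Nhi : ℤ} {ε : ℝ} {m : ℕ} (hmn : m + 2 ≤ n)
    (hesa : ESAhyp a (dt T n) T ε h Nlo Nhi) :
    Ib T n a h Nlo Nhi (m + 2) (m + 1) ≤
      (1 + ε) * (T ^ a * ((dt T n) ^ (1 - a) * ((2 : ℝ) ^ (1 - a) - 1) / (1 - a))) := by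
  have hn : (2 : ℝ) ≤ n := by exact_mod_cast (by omega : 2 ≤ n)
  have hd : 0 < dt T n := div_pos hT (by linarith)
  have hd2 : 2 * dt T n ≤ T := by
    unfold dt
    rw [← mul_div_assoc, div_le_iff₀ (by linarith)]
    nlinarith
  have hIb : Ib T n a h Nlo Nhi (m + 2) (m + 1) = ∫ x in (dt T n)..(2 * dt T n),
      ∑ i ∈ Finset.Icc (Nlo + 1) Nhi, thESA a h i * Real.exp (-(lamESA h i) * (x / T)) := by
    rw [intervalIntegral.integral_finsetSum
      (fun i _ => Continuous.intervalIntegrable (by fun_prop) _ _)]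
    unfold Ib
    refine Finset.sum_congr rfl fun i _ => ?_
    rw [intervalIntegral.integral_const_mul, intervalIntegral.integral_comp_sub_left
      (fun x => Real.exp (-(lamESA h i) * x / T))]
    have hlow : tk T n (m + 2) - tk T n (m + 1) = dt T n := by
      simp only [tk]; push_cast; ring
    have hup : tk T n (m + 2) - tk T n (m + 1 - 1) = 2 * dt T n := by
      simp only [tk, Nat.add_sub_cancel]; push_cast; ring
    simp only [hlow, hup, mul_div_assoc]
  have hrpow : IntervalIntegrable (fun x : ℝ => x ^ (-a)) volume (dt T n) (2 * dt T n) :=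
    intervalIntegral.intervalIntegrable_rpow' (by linarith)
  have hint : ∫ x in (dt T n)..(2 * dt T n), (1 + ε) * (T ^ a * x ^ (-a)) =
      (1 + ε) * (T ^ a * ((dt T n) ^ (1 - a) * ((2 : ℝ) ^ (1 - a) - 1) / (1 - a))) := by
    rw [intervalIntegral.integral_const_mul, intervalIntegral.integral_const_mul,
      integral_rpow (Or.inl (by linarith)), neg_add_eq_sub, Real.mul_rpow (by norm_num) hd.le]
    ring
  rw [hIb, ← hint]
  refine intervalIntegral.integral_mono_on (by linarith)
    (Continuous.intervalIntegrable (by fun_prop) _ _)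
    ((hrpow.const_mul _).const_mul _) fun x hx => ?_
  have hx0 : 0 < x := hd.trans_le hx.1
  have hs := (abs_le.mp (hesa (x / T)
    ⟨div_le_div_of_nonneg_right hx.1 hT.le, (div_le_one hT).mpr (hx.2.trans hd2)⟩)).1
  have hpow : (x / T) ^ (-a) = T ^ a * x ^ (-a) := by
    rw [Real.div_rpow hx0.le hT.le, Real.rpow_neg hT.le, div_inv_eq_mul, mul_comm]
  rw [← hpow]
  linarith

/-- The coefficients of the fast ESA scheme sum to one. -/
theorem sum_bcoef_eq_one (T : ℝ) (n : ℕ) (a h : ℝ) (Nlo Nhi : ℤ) (m : ℕ) :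
    ∑ l ∈ Finset.range (m + 2), bcoef T n a h Nlo Nhi (m + 2) l = 1 := by
  rw [Finset.sum_range_succ, Finset.sum_range_succ']
  have hmid : ∀ l ∈ Finset.range m, bcoef T n a h Nlo Nhi (m + 2) (l + 1) =
      T ^ (-a) * (dt T n) ^ (a - 1) * (1 - a) *
        (Ib T n a h Nlo Nhi (m + 2) (l + 1 + 1) - Ib T n a h Nlo Nhi (m + 2) (l + 1)) := by
    intro l hl
    rw [Finset.mem_range] at hl
    rw [bcoef, if_neg (by omega), if_neg (by omega), if_neg (by omega)]
  rw [Finset.sum_congr rfl hmid, ← Finset.mul_sum,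
    Finset.sum_range_sub (fun l => Ib T n a h Nlo Nhi (m + 2) (l + 1))]
  simp only [bcoef, show m + 2 ≠ 1 by omega, show m + 1 ≠ 0 by omega,
    show m + 2 - 1 = m + 1 by omega, if_true, if_false]
  ring

/-- Lemma 5 iv): under the ESA hypothesis, ε_k ≤ ε (2^{1−α_k} − 1), hence
Σ_{l=0}^{k−1} b_l^k + 2 ε_k ≤ 1 + 2 ε (2^{1−α_k} − 1) ≤ 1 + 2ε. -/
theorem bcoef_sum_plus_epsk_le
    (T : ℝ) (hT : 1 ≤ T) (n : ℕ) (hn : 0 < n)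
    (alo ahi : ℝ) (halo : 0 < alo) (hlh : alo ≤ ahi) (hahi : ahi < 1)
    (αf : ℝ → ℝ) (hα : ∀ s ∈ Set.Icc (0:ℝ) T, αf s ∈ Set.Icc alo ahi)
    (h : ℝ) (hh : 0 < h) (Nlo Nhi : ℤ) (hN : Nlo < Nhi)
    (ε : ℝ) (hε : ε ∈ Set.Ioo (0:ℝ) 1)
    (k : ℕ) (hk2 : 2 ≤ k) (hkn : k ≤ n)
    (hesa : ESAhyp (αf (tk T n k)) (dt T n) T ε h Nlo Nhi) :
    epsk T n (αf (tk T n k)) h ε Nlo Nhi k ≤ ε * ((2:ℝ) ^ (1 - αf (tk T n k)) - 1)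
      ∧ (∑ l ∈ Finset.range k, bcoef T n (αf (tk T n k)) h Nlo Nhi k l)
          + 2 * epsk T n (αf (tk T n k)) h ε Nlo Nhi k
            ≤ 1 + 2 * ε * ((2:ℝ) ^ (1 - αf (tk T n k)) - 1)
      ∧ 1 + 2 * ε * ((2:ℝ) ^ (1 - αf (tk T n k)) - 1) ≤ 1 + 2 * ε := by
  obtain ⟨m, rfl⟩ : ∃ m, k = m + 2 := ⟨k - 2, by omega⟩
  have hT0 : 0 < T := by linarith
  have hn0 : (0 : ℝ) < n := by exact_mod_cast hn
  have hd : 0 < dt T n := div_pos hT0 hn0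
  have hkn' : ((m + 2 : ℕ) : ℝ) ≤ n := by exact_mod_cast hkn
  have htk : tk T n (m + 2) ∈ Set.Icc (0 : ℝ) T := by
    refine ⟨mul_nonneg (Nat.cast_nonneg _) hd.le, ?_⟩
    calc tk T n (m + 2) ≤ n * dt T n := mul_le_mul_of_nonneg_right hkn' hd.le
      _ = T := mul_div_cancel₀ T hn0.ne'
  obtain ⟨hlo, hhi⟩ := hα _ htk
  generalize αf (tk T n (m + 2)) = a at *
  have ha1 : 0 < 1 - a := by linarith
  have hε0 : 0 < ε := hε.1
  have hTT : T ^ (-a) * T ^ a = 1 := by rw [← Real.rpow_add hT0]; simp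
  have hdd : (dt T n) ^ (a - 1) * (dt T n) ^ (1 - a) = 1 := by rw [← Real.rpow_add hd]; simp
  have heps : epsk T n a h ε Nlo Nhi (m + 2) ≤ ε * ((2 : ℝ) ^ (1 - a) - 1) := by
    have hC : 0 ≤ (ε / (1 + ε)) * T ^ (-a) * (dt T n) ^ (a - 1) * (1 - a) := by positivity
    calc epsk T n a h ε Nlo Nhi (m + 2)
        ≤ (ε / (1 + ε)) * T ^ (-a) * (dt T n) ^ (a - 1) * (1 - a) *
          ((1 + ε) * (T ^ a * ((dt T n) ^ (1 - a) * ((2 : ℝ) ^ (1 - a) - 1) / (1 - a)))) :=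
          mul_le_mul_of_nonneg_left (Ib_penultimate_le hT0 (by linarith) hkn hesa) hC
      _ = (ε / (1 + ε) * (1 + ε)) * (T ^ (-a) * T ^ a) *
          ((dt T n) ^ (a - 1) * (dt T n) ^ (1 - a)) * ((1 - a) / (1 - a)) *
          ((2 : ℝ) ^ (1 - a) - 1) := by ring
      _ = ε * ((2 : ℝ) ^ (1 - a) - 1) := by
          rw [hTT, hdd, div_self ha1.ne', div_mul_cancel₀ ε (by positivity)]; ring
  have htwo : (2 : ℝ) ^ (1 - a) ≤ 2 := by
    calc (2 : ℝ) ^ (1 - a) ≤ (2 : ℝ) ^ (1 : ℝ) :=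
          Real.rpow_le_rpow_of_exponent_le (by norm_num) (by linarith)
      _ = 2 := Real.rpow_one 2
  refine ⟨heps, ?_, by nlinarith⟩
  rw [sum_bcoef_eq_one]
  linarith
end

section
/- Suppose the ESA hypothesis with tolerance ε ∈ (0,1) holds for each α_k, 1 ≤ k ≤ n. Let m ≥ 2 be an integer, Δx = x_R/m, and let real numbers u_j^k (0 ≤ j ≤ m, 0 ≤ k ≤ n) and f_j^k (1 ≤ j ≤ m−1, 1 ≤ k ≤ n) satisfy, for all 1 ≤ j ≤ m−1 and 1 ≤ k ≤ n, −u_{j+1}^k + (2 + s_k)·u_j^k − u_{j−1}^k = s_k·Σ_{l=1}^{k−1} b_l^k·u_j^l + s_k·b_0^k·u_j^0 + Δx²·f_j^k, together with u_0^k = u_m^k = 0 for 1 ≤ k ≤ n. Set c_f = max_{1≤k≤n} max_{1≤j≤m−1} |f_j^k| and c_γ = max_{1≤k≤n} Γ(1−α_k). Then for every 1 ≤ k ≤ n, max_{1≤j≤m−1} |u_j^k| ≤ (1+2ε)^k · max_{1≤j≤m−1} |u_j^0| + c_f·c_γ·((1+2ε)^k/(1−ε))·T^{ᾱ}. -/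
open Real MeasureTheory Finset

/-- `s_k = Δx² Δt^{-a} / Γ(2-a)` (with `a` the order at level `k`). -/
noncomputable def skcoef (T : ℝ) (n : ℕ) (a Dx : ℝ) : ℝ :=
  Dx ^ 2 * (dt T n) ^ (-a) / Real.Gamma (2 - a)

/-- The exponential sum `Σ_i θ_{a,i} e^{-λ_i s}` approximating `s^{-a}`. -/
noncomputable def esaSum (a h : ℝ) (Nlo Nhi : ℤ) (s : ℝ) : ℝ :=
  ∑ i ∈ Finset.Icc (Nlo + 1) Nhi, thESA a h i * Real.exp (-(lamESA h i) * s)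

lemma thESA_nonneg {a h : ℝ} (ha : 0 < a) (hh : 0 < h) (i : ℤ) : 0 ≤ thESA a h i := by
  have := Real.Gamma_pos_of_pos ha
  unfold thESA
  positivity

lemma tk_sub_tk_pred (T : ℝ) (n : ℕ) {j : ℕ} (hj : 1 ≤ j) :
    tk T n j - tk T n (j - 1) = dt T n := by
  simp only [tk, Nat.cast_sub hj, Nat.cast_one]
  ring

/-- The integral of an increasing exponential is bounded by its endpoint values. -/
lemma integral_exp_mem_Icc {T l t x y : ℝ} (hT : 0 < T) (hl : 0 ≤ l) (hxy : x ≤ y) :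
    (∫ τ in x..y, Real.exp (-l * (t - τ) / T)) ∈
      Set.Icc ((y - x) * Real.exp (-l * ((t - x) / T)))
        ((y - x) * Real.exp (-l * ((t - y) / T))) := by
  have hcont : Continuous fun τ : ℝ => Real.exp (-l * (t - τ) / T) := by fun_prop
  have hmono : ∀ p q : ℝ, p ≤ q →
      Real.exp (-l * ((t - p) / T)) ≤ Real.exp (-l * ((t - q) / T)) := by
    intro p q hpq
    have : (t - q) / T ≤ (t - p) / T := by gcongr
    exact Real.exp_le_exp.2 (by nlinarith)
  constructor
  · have := intervalIntegral.integral_mono_on (μ := volume) hxy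
      (intervalIntegrable_const (c := Real.exp (-l * ((t - x) / T))))
      (hcont.intervalIntegrable x y) (fun τ hτ => by
        rw [mul_div_assoc]; exact hmono _ _ hτ.1)
    simpa using this
  · have := intervalIntegral.integral_mono_on (μ := volume) hxy
      (hcont.intervalIntegrable x y)
      (intervalIntegrable_const (c := Real.exp (-l * ((t - y) / T)))) (fun τ hτ => by
        rw [mul_div_assoc]; exact hmono _ _ hτ.2)
    simpa using this

lemma Ib_mem_Icc {T a h : ℝ} {n : ℕ} (hT : 0 < T) (ha : 0 < a) (hh : 0 < h) (Nlo Nhi : ℤ)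
    (k : ℕ) {j : ℕ} (hj : 1 ≤ j) :
    Ib T n a h Nlo Nhi k j ∈
      Set.Icc (dt T n * esaSum a h Nlo Nhi ((tk T n k - tk T n (j - 1)) / T))
        (dt T n * esaSum a h Nlo Nhi ((tk T n k - tk T n j) / T)) := by
  have hd := tk_sub_tk_pred T n hj
  have hdt : 0 ≤ dt T n := by unfold dt; positivity
  have key := fun i : ℤ => integral_exp_mem_Icc (t := tk T n k) hT
    (Real.exp_pos ((i : ℝ) * h)).le (show tk T n (j - 1) ≤ tk T n j by linarith)
  simp only [hd] at key
  constructor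
  · unfold esaSum Ib
    rw [Finset.mul_sum]
    refine Finset.sum_le_sum fun i _ => ?_
    rw [mul_left_comm]
    exact mul_le_mul_of_nonneg_left (key i).1 (thESA_nonneg ha hh i)
  · unfold esaSum Ib
    rw [Finset.mul_sum]
    refine Finset.sum_le_sum fun i _ => ?_
    rw [mul_left_comm]
    exact mul_le_mul_of_nonneg_left (key i).2 (thESA_nonneg ha hh i)

lemma Ib_le_succ {T a h : ℝ} {n : ℕ} (hT : 0 < T) (ha : 0 < a) (hh : 0 < h) (Nlo Nhi : ℤ)
    (k : ℕ) {j : ℕ} (hj : 1 ≤ j) :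
    Ib T n a h Nlo Nhi k j ≤ Ib T n a h Nlo Nhi k (j + 1) :=
  (Ib_mem_Icc hT ha hh Nlo Nhi k hj).2.trans
    (Ib_mem_Icc hT ha hh Nlo Nhi k (Nat.le_add_left 1 j)).1

/-- The coefficients `T^{-a} Δt^{a-1} (1-a) Ib k j`, whose differences are the `bcoef`. -/
noncomputable def wcoef (T : ℝ) (n : ℕ) (a h : ℝ) (Nlo Nhi : ℤ) (k j : ℕ) : ℝ :=
  T ^ (-a) * (dt T n) ^ (a - 1) * (1 - a) * Ib T n a h Nlo Nhi k j

lemma rpow_scaling {T d x a : ℝ} (hT : 0 < T) (hd : 0 < d) (hx : 0 < x) :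
    T ^ (-a) * d ^ (a - 1) * (1 - a) * (d * (x / T) ^ (-a)) = (1 - a) * (d / x) ^ a := by
  rw [Real.div_rpow hx.le hT.le, Real.div_rpow hd.le hx.le, Real.rpow_sub_one hd.ne',
    Real.rpow_neg hx.le]
  have := (Real.rpow_pos_of_pos hT (-a)).ne'
  have := (Real.rpow_pos_of_pos hx a).ne'
  field_simp

section Coefficients

variable {T a h ε : ℝ} {n : ℕ} {Nlo Nhi : ℤ} {k : ℕ}

lemma tk_div_mem_Icc (hT : 0 < T) (hn : 0 < n) {p : ℕ} (hp : 1 ≤ p) (hpn : p ≤ n) :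
    tk T n p / T ∈ Set.Icc (dt T n / T) 1 := by
  have hp' : (1 : ℝ) ≤ p := by exact_mod_cast hp
  have hpn' : (p : ℝ) ≤ n := by exact_mod_cast hpn
  have hn' : (0 : ℝ) < n := by exact_mod_cast hn
  have hd : 0 < dt T n := by unfold dt; positivity
  constructor
  · unfold tk
    gcongr
    nlinarith
  · rw [div_le_one hT, tk, dt, mul_div_assoc', div_le_iff₀ hn']
    nlinarith

lemma wcoef_prefactor_nonneg (hT : 0 < T) (ha1 : a < 1) :
    0 ≤ T ^ (-a) * (dt T n) ^ (a - 1) * (1 - a) := by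
  have hd : 0 ≤ dt T n := by unfold dt; positivity
  have : 0 < 1 - a := by linarith
  positivity

lemma le_wcoef_one (hT : 0 < T) (hn : 0 < n) (ha : 0 < a) (ha1 : a < 1) (hh : 0 < h)
    (hesa : ESAhyp a (dt T n) T ε h Nlo Nhi) (hk : 1 ≤ k) (hkn : k ≤ n) :
    (1 - ε) * ((1 - a) * (dt T n / tk T n k) ^ a) ≤ wcoef T n a h Nlo Nhi k 1 := by
  have hn' : (0 : ℝ) < n := by exact_mod_cast hn
  have hd : 0 < dt T n := by unfold dt; positivity
  have hk' : (0 : ℝ) < k := by exact_mod_cast hk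
  have ht : 0 < tk T n k := by unfold tk; positivity
  have h1 := (abs_le.1 (hesa _ (tk_div_mem_Icc hT hn hk hkn))).2
  have h2 := (Ib_mem_Icc (n := n) hT ha hh Nlo Nhi k le_rfl).1
  have h0 : tk T n (1 - 1) = 0 := by simp [tk]
  rw [h0, sub_zero] at h2
  rw [← rpow_scaling hT hd ht, wcoef, mul_left_comm]
  refine mul_le_mul_of_nonneg_left (le_trans ?_ h2) (wcoef_prefactor_nonneg hT ha1)
  rw [mul_left_comm]
  refine mul_le_mul_of_nonneg_left ?_ hd.le
  unfold esaSum
  linarith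

lemma wcoef_pred_le (hT : 0 < T) (hn : 0 < n) (ha : 0 < a) (ha1 : a < 1) (hh : 0 < h)
    (hε : 0 < ε) (hesa : ESAhyp a (dt T n) T ε h Nlo Nhi) (hk : 2 ≤ k) :
    wcoef T n a h Nlo Nhi k (k - 1) ≤ 1 + ε := by
  have hn' : (0 : ℝ) < n := by exact_mod_cast hn
  have hd : 0 < dt T n := by unfold dt; positivity
  have h1 := (abs_le.1 (hesa _ (tk_div_mem_Icc hT hn le_rfl hn))).1
  have h2 := (Ib_mem_Icc (n := n) hT ha hh Nlo Nhi k (show 1 ≤ k - 1 by omega)).2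
  have h0 : tk T n 1 = dt T n := by simp [tk]
  rw [tk_sub_tk_pred T n (by omega : 1 ≤ k)] at h2
  rw [h0] at h1
  have h3 := rpow_scaling (a := a) hT hd hd
  rw [div_self hd.ne', Real.one_rpow, mul_one] at h3
  calc wcoef T n a h Nlo Nhi k (k - 1)
      ≤ T ^ (-a) * (dt T n) ^ (a - 1) * (1 - a) *
          ((1 + ε) * (dt T n * (dt T n / T) ^ (-a))) := by
        refine mul_le_mul_of_nonneg_left (h2.trans ?_) (wcoef_prefactor_nonneg hT ha1)
        rw [mul_left_comm]
        refine mul_le_mul_of_nonneg_left ?_ hd.le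
        unfold esaSum
        linarith
    _ = (1 + ε) * (1 - a) := by rw [mul_left_comm, h3]
    _ ≤ 1 + ε := by nlinarith

lemma le_bcoef_zero (hT : 0 < T) (hn : 0 < n) (ha : 0 < a) (ha1 : a < 1) (hh : 0 < h)
    (hε : ε ∈ Set.Ioo (0 : ℝ) 1) (hesa : ESAhyp a (dt T n) T ε h Nlo Nhi) (hk : 1 ≤ k)
    (hkn : k ≤ n) :
    (1 - ε) * ((1 - a) * (dt T n / tk T n k) ^ a) ≤ bcoef T n a h Nlo Nhi k 0 := by
  by_cases hk1 : k = 1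
  · subst hk1
    have hn' : (0 : ℝ) < n := by exact_mod_cast hn
    have hd : 0 < dt T n := by unfold dt; positivity
    have h0 : tk T n 1 = dt T n := by simp [tk]
    rw [h0, div_self hd.ne', Real.one_rpow]
    simp only [bcoef, if_true]
    nlinarith [hε.1, hε.2]
  · have := le_wcoef_one hT hn ha ha1 hh hesa hk hkn
    simpa [bcoef, hk1, wcoef] using this

lemma bcoef_zero_nonneg (hT : 0 < T) (hn : 0 < n) (ha : 0 < a) (ha1 : a < 1) (hh : 0 < h)
    (hε : ε ∈ Set.Ioo (0 : ℝ) 1) (hesa : ESAhyp a (dt T n) T ε h Nlo Nhi) (hk : 1 ≤ k)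
    (hkn : k ≤ n) : 0 ≤ bcoef T n a h Nlo Nhi k 0 := by
  refine le_trans ?_ (le_bcoef_zero hT hn ha ha1 hh hε hesa hk hkn)
  have : 0 < 1 - ε := by linarith [hε.2]
  have : 0 < 1 - a := by linarith
  have : 0 ≤ dt T n / tk T n k := by unfold tk dt; positivity
  positivity

lemma sum_abs_bcoef_le (hT : 0 < T) (hn : 0 < n) (ha : 0 < a) (ha1 : a < 1) (hh : 0 < h)
    (hε : 0 < ε) (hesa : ESAhyp a (dt T n) T ε h Nlo Nhi) (hk : 1 ≤ k) :
    bcoef T n a h Nlo Nhi k 0 + ∑ l ∈ Finset.Icc 1 (k - 1), |bcoef T n a h Nlo Nhi k l|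
      ≤ 1 + 2 * ε := by
  obtain rfl | hk2 : k = 1 ∨ 2 ≤ k := by omega
  · simp [bcoef, hε.le]
  · obtain ⟨p, rfl⟩ := Nat.exists_eq_add_of_le' hk2
    have hw := wcoef_pred_le hT hn ha ha1 hh hε hesa hk2
    set w := wcoef T n a h Nlo Nhi (p + 2) with hw_def
    have hb0 : bcoef T n a h Nlo Nhi (p + 2) 0 = w 1 := by simp [bcoef, hw_def, wcoef]
    have hbtop : bcoef T n a h Nlo Nhi (p + 2) (p + 1) = 1 - w (p + 1) := by
      simp [bcoef, hw_def, wcoef]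
    have hbmid : ∀ l ∈ Finset.Icc 1 p,
        |bcoef T n a h Nlo Nhi (p + 2) l| = w (l + 1) - w l := by
      intro l hl
      rw [Finset.mem_Icc] at hl
      have hl0 : l ≠ 0 := by omega
      have hl1 : l ≠ p + 1 := by omega
      have : bcoef T n a h Nlo Nhi (p + 2) l = w (l + 1) - w l := by
        simp [bcoef, hl0, hl1, hw_def, wcoef, mul_sub]
      rw [this, abs_of_nonneg]
      exact sub_nonneg.2 (mul_le_mul_of_nonneg_left (Ib_le_succ hT ha hh Nlo Nhi _ hl.1)
        (wcoef_prefactor_nonneg hT ha1))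
    have htel : ∑ l ∈ Finset.Icc 1 p, (w (l + 1) - w l) = w (p + 1) - w 1 := by
      rw [← Finset.Ico_succ_right_eq_Icc]
      exact Finset.sum_Ico_sub w (by simp)
    rw [show p + 2 - 1 = p + 1 by omega] at hw ⊢
    rw [Finset.sum_Icc_succ_top (by omega), Finset.sum_congr rfl hbmid, htel, hb0, hbtop]
    rcases abs_cases (1 - w (p + 1)) with h | h <;> linarith

lemma skcoef_pos (hT : 0 < T) (hn : 0 < n) (ha1 : a < 1) {Dx : ℝ} (hDx : 0 < Dx) :
    0 < skcoef T n a Dx := by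
  have hd : 0 < dt T n := by unfold dt; positivity
  have := Real.Gamma_pos_of_pos (show 0 < 2 - a by linarith)
  unfold skcoef
  positivity

/-- The mesh factor `Δx² = s_k Γ(2-a) Δt^a` is controlled by the initial coefficient. -/
lemma sq_le_skcoef_mul (hT : 1 ≤ T) (hn : 0 < n) (ha : 0 < a) (ha1 : a < 1) (hh : 0 < h)
    (hε : ε ∈ Set.Ioo (0 : ℝ) 1) (hesa : ESAhyp a (dt T n) T ε h Nlo Nhi) (hk : 1 ≤ k)
    (hkn : k ≤ n) {Dx : ℝ} (hDx : 0 < Dx) {ahi : ℝ} (hahi : a ≤ ahi) :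
    Dx ^ 2 ≤ skcoef T n a Dx *
      (bcoef T n a h Nlo Nhi k 0 * (Real.Gamma (1 - a) / (1 - ε) * T ^ ahi)) := by
  have hT0 : 0 < T := by linarith
  have hn' : (0 : ℝ) < n := by exact_mod_cast hn
  have hd : 0 < dt T n := by unfold dt; positivity
  have hk' : (0 : ℝ) < k := by exact_mod_cast hk
  have ht : 0 < tk T n k := by unfold tk; positivity
  have hΓ := Real.Gamma_pos_of_pos (show 0 < 1 - a by linarith)
  have hΓ2 : Real.Gamma (2 - a) = (1 - a) * Real.Gamma (1 - a) := by
    rw [← Real.Gamma_add_one (by linarith)]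
    ring_nf
  have hε' : 0 < 1 - ε := by linarith [hε.2]
  have ha' : 0 < 1 - a := by linarith
  have hs := skcoef_pos hT0 hn ha1 hDx
  have hb := le_bcoef_zero hT0 hn ha ha1 hh hε hesa hk hkn
  have hb0 := bcoef_zero_nonneg hT0 hn ha ha1 hh hε hesa hk hkn
  have htT : tk T n k ^ a ≤ T ^ ahi := by
    have := (tk_div_mem_Icc hT0 hn hk hkn).2
    rw [div_le_one hT0] at this
    exact (Real.rpow_le_rpow ht.le this ha.le).trans (Real.rpow_le_rpow_of_exponent_le hT hahi)
  calc Dx ^ 2 = skcoef T n a Dx * ((1 - ε) * ((1 - a) * (dt T n / tk T n k) ^ a) *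
        (Real.Gamma (1 - a) / (1 - ε) * tk T n k ^ a)) := by
        have h1 := (Real.rpow_pos_of_pos hd a).ne'
        have h2 := (Real.rpow_pos_of_pos ht a).ne'
        rw [skcoef, hΓ2, Real.div_rpow hd.le ht.le, Real.rpow_neg hd.le]
        field_simp
    _ ≤ _ := by gcongr

end Coefficients

/-- Discrete maximum principle for `-v_{j+1} + (2+s) v_j - v_{j-1} = r_j`. -/
lemma abs_le_of_discrete_elliptic {m : ℕ} {v r : ℕ → ℝ} {s B : ℝ} (hs : 0 < s)
    (hv0 : v 0 = 0) (hvm : v m = 0)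
    (hv : ∀ j ∈ Finset.Icc 1 (m - 1), -v (j + 1) + (2 + s) * v j - v (j - 1) = r j)
    (hr : ∀ j ∈ Finset.Icc 1 (m - 1), |r j| ≤ s * B) :
    ∀ j ∈ Finset.Icc 1 (m - 1), |v j| ≤ B := by
  intro j hj
  obtain ⟨i, hi, hmax⟩ := Finset.exists_max_image (Finset.Icc 1 (m - 1)) (fun j => |v j|) ⟨j, hj⟩
  have hle : ∀ l, l ≤ m → |v l| ≤ |v i| := by
    intro l hl
    by_cases h0 : l = 0
    · simp [h0, hv0]
    by_cases h1 : l = m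
    · simp [h1, hvm]
    exact hmax l (Finset.mem_Icc.2 (by omega))
  have hi' := Finset.mem_Icc.1 hi
  have h1 := abs_le.1 (hle (i + 1) (by omega))
  have h2 := abs_le.1 (hle (i - 1) (by omega))
  have h3 := abs_le.1 (hr i hi)
  have h4 := hv i hi
  refine (hmax j hj).trans (le_of_mul_le_mul_left ?_ hs)
  rcases abs_cases (v i) with h | h <;> rw [h.1] at h1 h2 ⊢ <;> nlinarith

/-- Growth bound for memory terms with total weight at most `R ≥ 1`. -/
lemma abs_memory_sum_le {k : ℕ} {b v : ℕ → ℝ} {R M Q : ℝ} (hk : 1 ≤ k) (hR : 1 ≤ R)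
    (hG : 0 ≤ M + Q) (hb0 : 0 ≤ b 0) (hb : b 0 + ∑ l ∈ Finset.Icc 1 (k - 1), |b l| ≤ R)
    (hv0 : |v 0| ≤ M) (hv : ∀ l ∈ Finset.Icc 1 (k - 1), |v l| ≤ R ^ l * (M + Q)) :
    |∑ l ∈ Finset.Icc 1 (k - 1), b l * v l| + b 0 * |v 0| + b 0 * Q ≤ R ^ k * (M + Q) := by
  have hR0 : 0 ≤ R := by linarith
  have h1 : |∑ l ∈ Finset.Icc 1 (k - 1), b l * v l| ≤
      (∑ l ∈ Finset.Icc 1 (k - 1), |b l|) * (R ^ (k - 1) * (M + Q)) := by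
    rw [Finset.sum_mul]
    refine (Finset.abs_sum_le_sum_abs _ _).trans (Finset.sum_le_sum fun l hl => ?_)
    rw [abs_mul]
    refine mul_le_mul_of_nonneg_left ((hv l hl).trans ?_) (abs_nonneg _)
    exact mul_le_mul_of_nonneg_right
      (pow_le_pow_right₀ hR (Finset.mem_Icc.1 hl).2) hG
  have h2 : b 0 * |v 0| + b 0 * Q ≤ b 0 * (R ^ (k - 1) * (M + Q)) := by
    rw [← mul_add]
    refine mul_le_mul_of_nonneg_left ?_ hb0
    have := one_le_pow₀ (n := k - 1) hR
    nlinarith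
  have h3 : (b 0 + ∑ l ∈ Finset.Icc 1 (k - 1), |b l|) * (R ^ (k - 1) * (M + Q)) ≤
      R * (R ^ (k - 1) * (M + Q)) := mul_le_mul_of_nonneg_right hb (by positivity)
  have h4 : R * (R ^ (k - 1) * (M + Q)) = R ^ k * (M + Q) := by
    rw [← mul_assoc, mul_pow_sub_one (by omega)]
  linarith

/-- Theorem 2 (stability of the fast ESA scheme): under the ESA hypothesis at every time level,
any solution of the scheme satisfies
max_j |u_j^k| ≤ (1+2ε)^k max_j |u_j^0| + c_f c_γ (1+2ε)^k/(1−ε) T^ᾱ. -/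
theorem fast_esa_scheme_stability
    (T : ℝ) (hT : 1 ≤ T) (n : ℕ) (hn : 0 < n)
    (alo ahi : ℝ) (halo : 0 < alo) (hlh : alo ≤ ahi) (hahi : ahi < 1)
    (αf : ℝ → ℝ) (hα : ∀ s ∈ Set.Icc (0:ℝ) T, αf s ∈ Set.Icc alo ahi)
    (h : ℝ) (hh : 0 < h) (Nlo Nhi : ℤ) (hN : Nlo < Nhi)
    (ε : ℝ) (hε : ε ∈ Set.Ioo (0:ℝ) 1)
    (hesa : ∀ k ∈ Finset.Icc 1 n, ESAhyp (αf (tk T n k)) (dt T n) T ε h Nlo Nhi)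
    (xR : ℝ) (hxR : 0 < xR) (m : ℕ) (hm : 2 ≤ m)
    (U F : ℕ → ℕ → ℝ)
    (hscheme : ∀ k ∈ Finset.Icc 1 n, ∀ j ∈ Finset.Icc 1 (m-1),
      -U k (j+1) + (2 + skcoef T n (αf (tk T n k)) (xR / m)) * U k j - U k (j-1)
        = skcoef T n (αf (tk T n k)) (xR / m) *
              (∑ l ∈ Finset.Icc 1 (k-1), bcoef T n (αf (tk T n k)) h Nlo Nhi k l * U l j)
          + skcoef T n (αf (tk T n k)) (xR / m) *
              bcoef T n (αf (tk T n k)) h Nlo Nhi k 0 * U 0 j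
          + (xR / m) ^ 2 * F k j)
    (hbc : ∀ k ∈ Finset.Icc 1 n, U k 0 = 0 ∧ U k m = 0) :
    ∀ k ∈ Finset.Icc 1 n, ∀ j ∈ Finset.Icc 1 (m-1),
      |U k j| ≤ (1 + 2 * ε) ^ k *
            ((Finset.Icc 1 (m-1)).sup' (Finset.nonempty_Icc.2 (by omega)) fun j => |U 0 j|)
        + ((Finset.Icc 1 n).sup' (Finset.nonempty_Icc.2 (by omega)) fun k =>
              (Finset.Icc 1 (m-1)).sup' (Finset.nonempty_Icc.2 (by omega)) fun j => |F k j|)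
          * ((Finset.Icc 1 n).sup' (Finset.nonempty_Icc.2 (by omega)) fun k =>
              Real.Gamma (1 - αf (tk T n k)))
          * ((1 + 2 * ε) ^ k / (1 - ε)) * T ^ ahi := by
  set M := (Finset.Icc 1 (m - 1)).sup' (Finset.nonempty_Icc.2 (by omega)) fun j => |U 0 j|
  set cf := (Finset.Icc 1 n).sup' (Finset.nonempty_Icc.2 (by omega)) fun k =>
    (Finset.Icc 1 (m - 1)).sup' (Finset.nonempty_Icc.2 (by omega)) fun j => |F k j|
  set cγ := (Finset.Icc 1 n).sup' (Finset.nonempty_Icc.2 (by omega)) fun k =>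
    Real.Gamma (1 - αf (tk T n k))
  have hT0 : 0 < T := by linarith
  have hn' : (0 : ℝ) < n := by exact_mod_cast hn
  have hm' : (0 : ℝ) < m := by exact_mod_cast (show 0 < m by omega)
  have hDx : 0 < xR / m := by positivity
  have hε' : 0 < 1 - ε := by linarith [hε.2]
  have hUM : ∀ j ∈ Finset.Icc 1 (m - 1), |U 0 j| ≤ M := fun j hj =>
    Finset.le_sup' (fun j => |U 0 j|) hj
  have hFc : ∀ k ∈ Finset.Icc 1 n, ∀ j ∈ Finset.Icc 1 (m - 1), |F k j| ≤ cf := by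
    intro k hk j hj
    refine (Finset.le_sup' (fun j => |F k j|) hj).trans ?_
    exact Finset.le_sup' (fun k => (Finset.Icc 1 (m - 1)).sup'
      (Finset.nonempty_Icc.2 (by omega)) fun j => |F k j|) hk
  have hΓc : ∀ k ∈ Finset.Icc 1 n, Real.Gamma (1 - αf (tk T n k)) ≤ cγ := fun k hk =>
    Finset.le_sup' (fun k => Real.Gamma (1 - αf (tk T n k))) hk
  have hαk : ∀ k ∈ Finset.Icc 1 n, αf (tk T n k) ∈ Set.Icc alo ahi := by
    intro k hk
    rw [Finset.mem_Icc] at hk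
    have := (tk_div_mem_Icc hT0 hn hk.1 hk.2).2
    rw [div_le_one hT0] at this
    exact hα _ ⟨by unfold tk dt; positivity, this⟩
  have hone : 1 ∈ Finset.Icc 1 n := Finset.mem_Icc.2 (by omega)
  have hjone : 1 ∈ Finset.Icc 1 (m - 1) := Finset.mem_Icc.2 (by omega)
  have hM0 : 0 ≤ M := (abs_nonneg _).trans (hUM 1 hjone)
  have hcf0 : 0 ≤ cf := (abs_nonneg _).trans (hFc 1 hone 1 hjone)
  have hcγ0 : 0 ≤ cγ :=
    (Real.Gamma_pos_of_pos (by linarith [(hαk 1 hone).2])).le.trans (hΓc 1 hone)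
  set Q := cf * (cγ / (1 - ε) * T ^ ahi) with hQ
  have hQ0 : 0 ≤ Q := by positivity
  suffices hmain : ∀ k ∈ Finset.Icc 1 n, ∀ j ∈ Finset.Icc 1 (m - 1),
      |U k j| ≤ (1 + 2 * ε) ^ k * (M + Q) by
    intro k hk j hj
    refine (hmain k hk j hj).trans_eq ?_
    rw [hQ]
    ring
  intro k
  induction k using Nat.strong_induction_on with
  | _ k ih =>
    intro hk
    obtain ⟨hk1, hkn⟩ := Finset.mem_Icc.1 hk
    obtain ⟨ha0, hahi'⟩ := hαk k hk
    have hes := hesa k hk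
    have hsch := hscheme k hk
    have hΓ := hΓc k hk
    set a := αf (tk T n k)
    have ha : 0 < a := by linarith
    have ha1 : a < 1 := by linarith
    have hb0 := bcoef_zero_nonneg hT0 hn ha ha1 hh hε hes hk1 hkn
    have hs := skcoef_pos hT0 hn ha1 hDx
    have hsq := sq_le_skcoef_mul hT hn ha ha1 hh hε hes hk1 hkn hDx hahi'
    have hbsum := sum_abs_bcoef_le hT0 hn ha ha1 hh hε.1 hes hk1
    set s := skcoef T n a (xR / m)
    refine abs_le_of_discrete_elliptic hs (hbc k hk).1 (hbc k hk).2 hsch fun j hj => ?_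
    have hmem := abs_memory_sum_le (v := fun l => U l j) hk1 (by linarith [hε.1])
      (add_nonneg hM0 hQ0) hb0 hbsum (hUM j hj) (fun l hl => by
        rw [Finset.mem_Icc] at hl
        exact ih l (by omega) (Finset.mem_Icc.2 (by omega)) j hj)
    have hF : (xR / m) ^ 2 * |F k j| ≤ s * (bcoef T n a h Nlo Nhi k 0 * Q) := by
      calc (xR / m) ^ 2 * |F k j|
          ≤ s * (bcoef T n a h Nlo Nhi k 0 * (Real.Gamma (1 - a) / (1 - ε) * T ^ ahi)) * cf :=
            mul_le_mul hsq (hFc k hk j hj) (abs_nonneg _) ((sq_nonneg _).trans hsq)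
        _ ≤ s * (bcoef T n a h Nlo Nhi k 0 * (cγ / (1 - ε) * T ^ ahi)) * cf := by gcongr
        _ = s * (bcoef T n a h Nlo Nhi k 0 * Q) := by rw [hQ]; ring
    refine (abs_add_three _ _ _).trans ?_
    rw [abs_mul, abs_mul, abs_mul, abs_mul, abs_of_pos hs, abs_of_nonneg hb0,
      abs_of_nonneg (sq_nonneg (xR / (m : ℝ)))]
    have := mul_le_mul_of_nonneg_left hmem hs.le
    linarith
end
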